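/- Let u(x,t) := ½|x|² − t + δ g(x,t) where g is smooth on ℝⁿ × (−∞,0], g(x,t) = R^{2−β} for R := (|x|²−t)^{1/2} > 2 with β ∈ (0,2), g = 0 for R < 1, and all first and second derivatives of g are bounded by a constant C on 1 < R < 2. Then for all sufficiently small δ > 0, D²ₓu > ½ I and ½ ≤ −u_t ≤ 3/2 everywhere on ℝⁿ × (−∞,0]; in particular u is convex in x and nonincreasing in t (parabolically convex). -/

import Mathlib

open Real

section RadialPower

variable {E : Type*} [NormedAddCommGroup E] [InnerProductSpace ℝ E]

theorem convexOn_univ_of_sndFDeriv_nonneg {f : E → ℝ} (hf : ContDiff ℝ 2 f)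
    (h : ∀ x v, 0 ≤ fderiv ℝ (fderiv ℝ f) x v v) : ConvexOn ℝ Set.univ f := by
  have hd : Differentiable ℝ f := hf.differentiable (by norm_num)
  have hd' : Differentiable ℝ (fderiv ℝ f) :=
    (hf.fderiv_right (m := 1) (by norm_num)).differentiable (by norm_num)
  refine ⟨convex_univ, fun x _ y _ a b ha hb hab => ?_⟩
  have hline : ∀ r : ℝ, HasDerivAt (fun r : ℝ => x + r • (y - x)) (y - x) r := fun r => by
    simpa using ((hasDerivAt_id r).smul_const (y - x)).const_add x
  have h1 : ∀ r : ℝ, HasDerivAt (fun r : ℝ => f (x + r • (y - x)))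
      (fderiv ℝ f (x + r • (y - x)) (y - x)) r := fun r =>
    (hd _).hasFDerivAt.comp_hasDerivAt r (hline r)
  have h2 : ∀ r : ℝ, HasDerivAt (fun r : ℝ => fderiv ℝ f (x + r • (y - x)) (y - x))
      (fderiv ℝ (fderiv ℝ f) (x + r • (y - x)) (y - x) (y - x)) r := fun r => by
    simpa using ((hd' _).hasFDerivAt.comp_hasDerivAt r (hline r)).clm_apply
      (hasDerivAt_const r (y - x))
  have e1 : deriv (fun r : ℝ => f (x + r • (y - x))) =
      fun r => fderiv ℝ f (x + r • (y - x)) (y - x) := funext fun r => (h1 r).deriv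
  have hc : ConvexOn ℝ Set.univ (fun r : ℝ => f (x + r • (y - x))) := by
    refine convexOn_univ_of_deriv2_nonneg (fun r => (h1 r).differentiableAt) ?_ fun r => ?_
    · rw [e1]
      exact fun r => (h2 r).differentiableAt
    · simp only [Function.iterate_succ, Function.iterate_zero, Function.comp_apply, id, e1]
      rw [(h2 r).deriv]
      exact h _ _
  have := hc.2 (Set.mem_univ 0) (Set.mem_univ 1) ha hb hab
  simp only [smul_eq_mul, mul_zero, mul_one, zero_add, zero_smul, add_zero, one_smul,
    add_sub_cancel] at this
  have e : a • x + b • y = x + b • (y - x) := by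
    rw [← eq_sub_iff_add_eq] at hab
    subst hab
    module
  rw [e]
  exact this

theorem hasFDerivAt_rpow_norm_sq_sub {a t : ℝ} {x : E} (hx : 0 < ‖x‖ ^ 2 - t) :
    HasFDerivAt (fun y : E => (‖y‖ ^ 2 - t) ^ a)
      ((a * (‖x‖ ^ 2 - t) ^ (a - 1)) • ((2 : ℝ) • innerSL ℝ x)) x := by
  have h : HasFDerivAt (fun y : E => ‖y‖ ^ 2 - t) ((2 : ℝ) • innerSL ℝ x) x := by
    have := (hasStrictFDerivAt_norm_sq x).hasFDerivAt.sub_const t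
    rwa [← Nat.cast_smul_eq_nsmul ℝ, Nat.cast_ofNat] at this
  exact h.rpow_const (Or.inl hx.ne')

theorem sndFDeriv_rpow_norm_sq_sub {a t : ℝ} {x : E} (hx : 0 < ‖x‖ ^ 2 - t) (v : E) :
    fderiv ℝ (fderiv ℝ (fun y : E => (‖y‖ ^ 2 - t) ^ a)) x v v =
      2 * a * (‖x‖ ^ 2 - t) ^ (a - 1) * ‖v‖ ^ 2 +
        4 * a * (a - 1) * (‖x‖ ^ 2 - t) ^ (a - 1 - 1) * inner ℝ x v ^ 2 := by
  have hev : fderiv ℝ (fun y : E => (‖y‖ ^ 2 - t) ^ a) =ᶠ[nhds x]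
      fun y => (a * (‖y‖ ^ 2 - t) ^ (a - 1)) • ((2 : ℝ) • innerSL ℝ y) := by
    have : ∀ᶠ y : E in nhds x, 0 < ‖y‖ ^ 2 - t :=
      (continuous_norm.pow 2 |>.sub continuous_const).continuousAt.eventually_const_lt hx
    filter_upwards [this] with y hy using (hasFDerivAt_rpow_norm_sq_sub hy).fderiv
  rw [hev.fderiv_eq, (((hasFDerivAt_rpow_norm_sq_sub (a := a - 1) hx).const_mul a).fun_smul
    ((innerSL ℝ).hasFDerivAt.fun_const_smul (2 : ℝ))).fderiv]
  have hL : ∀ y w : E, (innerSL ℝ : E →L[ℝ] E →L[ℝ] ℝ) y w = inner ℝ y w := fun _ _ => rfl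
  simp only [add_apply, smul_apply, ContinuousLinearMap.smulRight_apply, hL,
    smul_eq_mul, real_inner_self_eq_norm_sq]
  ring

theorem neg_norm_sq_le_sndFDeriv_rpow_norm_sq_sub {a t : ℝ} {x : E} (ha : 0 < a) (ha1 : a < 1)
    (ht : t ≤ 0) (hx : 1 ≤ ‖x‖ ^ 2 - t) (v : E) :
    -‖v‖ ^ 2 ≤ fderiv ℝ (fderiv ℝ (fun y : E => (‖y‖ ^ 2 - t) ^ a)) x v v := by
  have hp : 0 < ‖x‖ ^ 2 - t := by linarith
  rw [sndFDeriv_rpow_norm_sq_sub hp]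
  set p := ‖x‖ ^ 2 - t with hpdef
  have hq : p ^ (a - 1 - 1) * p ≤ 1 := by
    rw [← rpow_add_one hp.ne', sub_add_cancel]
    exact rpow_le_one_of_one_le_of_nonpos hx (by linarith)
  have hq0 : 0 < p ^ (a - 1 - 1) := rpow_pos_of_pos hp _
  have hin : inner ℝ x v ^ 2 ≤ p * ‖v‖ ^ 2 := by
    have h1 : inner ℝ x v ^ 2 ≤ (‖x‖ * ‖v‖) ^ 2 := by
      rw [← sq_abs]
      exact pow_le_pow_left₀ (abs_nonneg _) (abs_real_inner_le_norm x v) 2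
    have h2 : ‖x‖ ^ 2 * ‖v‖ ^ 2 ≤ p * ‖v‖ ^ 2 :=
      mul_le_mul_of_nonneg_right (by linarith) (sq_nonneg _)
    linarith [mul_pow ‖x‖ ‖v‖ 2]
  have hb : p ^ (a - 1 - 1) * inner ℝ x v ^ 2 ≤ ‖v‖ ^ 2 := by
    calc p ^ (a - 1 - 1) * inner ℝ x v ^ 2 ≤ p ^ (a - 1 - 1) * (p * ‖v‖ ^ 2) := by gcongr
      _ = (p ^ (a - 1 - 1) * p) * ‖v‖ ^ 2 := by ring
      _ ≤ 1 * ‖v‖ ^ 2 := by gcongr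
      _ = ‖v‖ ^ 2 := one_mul _
  have hb0 : 0 ≤ p ^ (a - 1 - 1) * inner ℝ x v ^ 2 := by positivity
  have hc : 4 * a * (1 - a) ≤ 1 := by nlinarith [sq_nonneg (2 * a - 1)]
  have hc0 : 0 ≤ 4 * a * (1 - a) := by nlinarith
  have hpos : 0 ≤ 2 * a * p ^ (a - 1) * ‖v‖ ^ 2 := by positivity
  nlinarith [mul_le_mul_of_nonneg_right hc hb0]

theorem abs_deriv_le_one_of_eq_rpow_sub {a b t : ℝ} (ha : 0 < a) (ha1 : a < 1) {f : ℝ → ℝ}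
    (hf : DifferentiableAt ℝ f t) (hbt : 1 ≤ b - t)
    (h : ∀ s ≤ t, f s = (b - s) ^ a) : |deriv f t| ≤ 1 := by
  have hp : 0 < b - t := by linarith
  have h1 : HasDerivWithinAt f (-1 * a * (b - t) ^ (a - 1)) (Set.Iic t) t :=
    (((hasDerivAt_id t).const_sub b).rpow_const (Or.inl hp.ne')).hasDerivWithinAt.congr
      (fun s hs => h s hs) (h t le_rfl)
  rw [(uniqueDiffWithinAt_Iic t).eq_deriv _ hf.hasDerivAt.hasDerivWithinAt h1]
  have h2 : (b - t) ^ (a - 1) ≤ 1 := rpow_le_one_of_one_le_of_nonpos hbt (by linarith)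
  have h3 : 0 < (b - t) ^ (a - 1) := rpow_pos_of_pos hp _
  rw [abs_le]
  constructor <;> nlinarith

theorem exists_bound_of_eq_rpow_norm_sq_sub [FiniteDimensional ℝ E] {a : ℝ} (ha : 0 < a)
    (ha1 : a < 1) {g : E → ℝ → ℝ} (hg : ContDiff ℝ (⊤ : ℕ∞) (Function.uncurry g))
    (h : ∀ x t, t ≤ 0 → 4 < ‖x‖ ^ 2 - t → g x t = (‖x‖ ^ 2 - t) ^ a) :
    ∃ M, 0 ≤ M ∧ ∀ x t, t ≤ 0 → |deriv (g x) t| ≤ M ∧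
      ∀ v, -M * ‖v‖ ^ 2 ≤ fderiv ℝ (fderiv ℝ fun y => g y t) x v v := by
  have hD : ContDiff ℝ (⊤ : ℕ∞) fun p : (E × ℝ) × E => fderiv ℝ (fun y => g y p.1.2) p.2 :=
    ContDiff.fderiv (f := fun (p : (E × ℝ) × E) y => g y p.1.2)
      (hg.comp (contDiff_snd.prodMk (contDiff_snd.comp (contDiff_fst.comp contDiff_fst))))
      contDiff_snd (by simp)
  have hH : Continuous fun p : E × ℝ => fderiv ℝ (fderiv ℝ fun y => g y p.2) p.1 :=
    (ContDiff.fderiv (f := fun (p : E × ℝ) => fderiv ℝ fun y => g y p.2) (n := 0) hD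
      contDiff_fst (by simp)).continuous
  have hT : Continuous fun p : E × ℝ => deriv (g p.1) p.2 := by
    have : Continuous fun p : E × ℝ => fderiv ℝ (g p.1) p.2 :=
      (ContDiff.fderiv (f := fun (p : E × ℝ) => g p.1) (n := 0)
        (hg.comp ((contDiff_fst.comp contDiff_fst).prodMk contDiff_snd))
        contDiff_snd (by simp)).continuous
    exact this.clm_apply continuous_const
  have hK : IsCompact (Metric.closedBall (0 : E) 2 ×ˢ Set.Icc (-4 : ℝ) 0) :=
    (isCompact_closedBall _ _).prod isCompact_Icc
  obtain ⟨A, hA⟩ := hK.exists_bound_of_continuousOn (E := E →L[ℝ] E →L[ℝ] ℝ) hH.continuousOn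
  obtain ⟨B, hB⟩ := hK.exists_bound_of_continuousOn hT.continuousOn
  refine ⟨max 1 (max A B), by simp, fun x t ht => ?_⟩
  rcases lt_or_ge 4 (‖x‖ ^ 2 - t) with hx | hx
  · constructor
    · have hd : DifferentiableAt ℝ (g x) t :=
        (hg.comp (contDiff_const.prodMk contDiff_id)).differentiable (by simp) t
      exact (abs_deriv_le_one_of_eq_rpow_sub ha ha1 hd (by linarith)
        fun s hs => h x s (by linarith) (by linarith)).trans (le_max_left _ _)
    · intro v
      have hev : (fun y => g y t) =ᶠ[nhds x] fun y => (‖y‖ ^ 2 - t) ^ a := by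
        have : ∀ᶠ y : E in nhds x, 4 < ‖y‖ ^ 2 - t :=
          (continuous_norm.pow 2 |>.sub continuous_const).continuousAt.eventually_const_lt hx
        filter_upwards [this] with y hy using h y t ht hy
      rw [hev.fderiv.fderiv_eq]
      have := neg_norm_sq_le_sndFDeriv_rpow_norm_sq_sub ha ha1 ht (by linarith : 1 ≤ ‖x‖ ^ 2 - t) v
      have := mul_le_mul_of_nonneg_right (le_max_left 1 (max A B)) (sq_nonneg ‖v‖)
      linarith
  · have hmem : (x, t) ∈ Metric.closedBall (0 : E) 2 ×ˢ Set.Icc (-4 : ℝ) 0 := by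
      refine ⟨?_, ?_, ht⟩
      · rw [mem_closedBall_zero_iff]
        nlinarith [norm_nonneg x]
      · change -4 ≤ t
        nlinarith [sq_nonneg ‖x‖]
    refine ⟨(hB _ hmem).trans ((le_max_right _ _).trans (le_max_right _ _)), fun v => ?_⟩
    have h1 := (fderiv ℝ (fderiv ℝ fun y => g y t) x).le_opNorm₂ v v
    have h2 : ‖fderiv ℝ (fderiv ℝ fun y => g y t) x‖ ≤ max 1 (max A B) :=
      (hA _ hmem).trans ((le_max_left _ _).trans (le_max_right _ _))
    have h3 := mul_le_mul_of_nonneg_right h2 (sq_nonneg ‖v‖)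
    rw [Real.norm_eq_abs] at h1
    nlinarith [neg_abs_le (fderiv ℝ (fderiv ℝ fun y => g y t) x v v)]

theorem sndFDeriv_half_norm_sq_sub_add {f : E → ℝ} (hf : ContDiff ℝ 2 f) (δ t : ℝ) (x v w : E) :
    fderiv ℝ (fderiv ℝ fun y => ‖y‖ ^ 2 / 2 - t + δ * f y) x v w =
      inner ℝ v w + δ * fderiv ℝ (fderiv ℝ f) x v w := by
  have hd' : Differentiable ℝ (fderiv ℝ f) :=
    (hf.fderiv_right (m := 1) (by norm_num)).differentiable (by norm_num)
  have h1 : (fderiv ℝ fun y => ‖y‖ ^ 2 / 2 - t + δ * f y) =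
      fun y => innerSL ℝ y + δ • fderiv ℝ f y := by
    ext y z
    have hsq : HasFDerivAt (fun y : E => ‖y‖ ^ 2 / 2) (innerSL ℝ y) y := by
      have := (hasStrictFDerivAt_norm_sq y).hasFDerivAt.mul_const (2⁻¹ : ℝ)
      rw [← Nat.cast_smul_eq_nsmul ℝ, Nat.cast_ofNat, inv_smul_smul₀ two_ne_zero] at this
      simpa only [div_eq_mul_inv] using this
    rw [((hsq.sub_const t).fun_add
      ((hf.differentiable (by norm_num) y).hasFDerivAt.const_mul δ)).fderiv]
  rw [h1, ((innerSL ℝ).hasFDerivAt.fun_add ((hd' x).hasFDerivAt.fun_const_smul δ)).fderiv]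
  simp only [add_apply, smul_apply, smul_eq_mul]
  rfl

end RadialPower

theorem EuclideanSpace.posDef_of_sub_half_smul_one {n : ℕ}
    {B : EuclideanSpace ℝ (Fin n) →L[ℝ] EuclideanSpace ℝ (Fin n) →L[ℝ] ℝ}
    (hsymm : ∀ v w, B v w = B w v) (hpos : ∀ v, v ≠ 0 → 1 / 2 * ‖v‖ ^ 2 < B v v) :
    ((Matrix.of fun i j : Fin n => B (EuclideanSpace.single i 1) (EuclideanSpace.single j 1)) -
      (1 / 2 : ℝ) • (1 : Matrix (Fin n) (Fin n) ℝ)).PosDef := by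
  refine Matrix.PosDef.of_dotProduct_mulVec_pos ?_ fun v hv => ?_
  · refine Matrix.IsHermitian.sub ?_ (Matrix.isHermitian_one.smul (by simp [IsSelfAdjoint]))
    ext i j
    simp [hsymm (EuclideanSpace.single j 1)]
  · have hsum : WithLp.toLp 2 v = ∑ i, v i • EuclideanSpace.single i (1 : ℝ) := by
      simpa using ((EuclideanSpace.basisFun (Fin n) ℝ).sum_repr (WithLp.toLp 2 v)).symm
    have hB : B (WithLp.toLp 2 v) (WithLp.toLp 2 v) = v ⬝ᵥ (Matrix.of fun i j : Fin n =>
        B (EuclideanSpace.single i 1) (EuclideanSpace.single j 1)).mulVec v := by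
      rw [hsum]
      simp only [map_sum, map_smul, sum_apply, smul_apply,
        dotProduct, Matrix.mulVec, Matrix.of_apply, smul_eq_mul, Finset.mul_sum]
      rw [Finset.sum_comm]
      exact Finset.sum_congr rfl fun i _ => Finset.sum_congr rfl fun j _ => by ring
    have hnorm : ‖WithLp.toLp 2 v‖ ^ 2 = v ⬝ᵥ v := by
      rw [EuclideanSpace.real_norm_sq_eq]
      exact Finset.sum_congr rfl fun i _ => pow_two _
    have := hpos (WithLp.toLp 2 v) (by simpa using hv)
    rw [hB, hnorm] at this
    simp only [star_trivial, Matrix.sub_mulVec, Matrix.smul_mulVec, Matrix.one_mulVec,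
      dotProduct_sub, dotProduct_smul, smul_eq_mul]
    linarith

/-- For `u(x,t) = ½|x|² − t + δ g(x,t)`, where `g` is smooth, equals `R^{2−β}` for
`R > 2`, vanishes for `R < 1`, and has first and second derivatives bounded on
`1 < R < 2`, all sufficiently small `δ > 0` give `D²ₓu > ½I` and `½ ≤ −u_t ≤ 3/2`
on `ℝⁿ × (−∞,0]`; in particular `u` is parabolically convex. -/
theorem parabolic_convexity_of_perturbation (n : ℕ) (hn : 1 ≤ n) (β : ℝ)
    (hβ : 0 < β ∧ β < 2) (C : ℝ)
    (g : EuclideanSpace ℝ (Fin n) → ℝ → ℝ)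
    (hg : ContDiff ℝ (⊤ : ℕ∞) (fun p : EuclideanSpace ℝ (Fin n) × ℝ => g p.1 p.2))
    (hg2 : ∀ x t, t ≤ 0 → 2 < Real.sqrt (‖x‖ ^ 2 - t) →
      g x t = Real.sqrt (‖x‖ ^ 2 - t) ^ (2 - β))
    (hg0 : ∀ x t, t ≤ 0 → Real.sqrt (‖x‖ ^ 2 - t) < 1 → g x t = 0)
    (hgC : ∀ x t, t ≤ 0 → 1 < Real.sqrt (‖x‖ ^ 2 - t) → Real.sqrt (‖x‖ ^ 2 - t) < 2 →
      ‖iteratedFDeriv ℝ 1 (fun p : EuclideanSpace ℝ (Fin n) × ℝ => g p.1 p.2) (x, t)‖ ≤ C ∧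
      ‖iteratedFDeriv ℝ 2 (fun p : EuclideanSpace ℝ (Fin n) × ℝ => g p.1 p.2) (x, t)‖ ≤ C) :
    ∃ δ₀ > 0, ∀ δ : ℝ, 0 < δ → δ < δ₀ →
      letI u : EuclideanSpace ℝ (Fin n) → ℝ → ℝ :=
        fun y s => ‖y‖ ^ 2 / 2 - s + δ * g y s
      ∀ (x : EuclideanSpace ℝ (Fin n)) (t : ℝ), t ≤ 0 →
        (Matrix.PosDef ((Matrix.of fun i j : Fin n =>
            fderiv ℝ (fun y => fderiv ℝ (fun z => u z t) y (EuclideanSpace.single j 1)) x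
              (EuclideanSpace.single i 1)) - (1 / 2 : ℝ) • (1 : Matrix (Fin n) (Fin n) ℝ))) ∧
        (1 / 2 ≤ -(deriv (fun s => u x s) t)) ∧ (-(deriv (fun s => u x s) t) ≤ 3 / 2) ∧
        (∀ x₁ x₂ : EuclideanSpace ℝ (Fin n), ∀ l : ℝ, 0 ≤ l → l ≤ 1 →
          u (l • x₁ + (1 - l) • x₂) t ≤ l * u x₁ t + (1 - l) * u x₂ t) ∧
        (∀ s : ℝ, s ≤ t → u x t ≤ u x s) := by
  have hg' : ContDiff ℝ (⊤ : ℕ∞) (Function.uncurry g) := hg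
  have hpow : ∀ x t, t ≤ 0 → 4 < ‖x‖ ^ 2 - t → g x t = (‖x‖ ^ 2 - t) ^ ((2 - β) / 2) := by
    intro x t ht hx
    have hp : 0 ≤ ‖x‖ ^ 2 - t := by linarith
    rw [hg2 x t ht (Real.lt_sqrt_of_sq_lt (by linarith)), Real.sqrt_eq_rpow, ← Real.rpow_mul hp]
    congr 1
    ring
  obtain ⟨M, hM, hbound⟩ := exists_bound_of_eq_rpow_norm_sq_sub (by linarith [hβ.2])
    (by linarith [hβ.1]) hg' hpow
  refine ⟨1 / (2 * (M + 1)), by positivity, fun δ hδ hδ₀ => ?_⟩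
  have hδM : δ * M < 1 / 2 := by
    rw [lt_div_iff₀ (by positivity)] at hδ₀
    nlinarith
  have hgx : ∀ t, ContDiff ℝ 2 fun y => g y t := fun t =>
    contDiff_infty.1 (hg'.comp (contDiff_id.prodMk contDiff_const)) 2
  have hgt : ∀ x, Differentiable ℝ (g x) := fun x =>
    (hg'.comp (contDiff_const.prodMk contDiff_id)).differentiable (by simp)
  have hux : ∀ t, ContDiff ℝ 2 fun y => ‖y‖ ^ 2 / 2 - t + δ * g y t := fun t =>
    (((contDiff_norm_sq ℝ).div_const 2).sub contDiff_const).add (contDiff_const.mul (hgx t))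
  have hut : ∀ x t, HasDerivAt (fun s => ‖x‖ ^ 2 / 2 - s + δ * g x s)
      (-1 + δ * deriv (g x) t) t := fun x t =>
    ((hasDerivAt_id t).const_sub _).add ((hgt x t).hasDerivAt.const_mul δ)
  have hδt : ∀ x t, t ≤ 0 → |δ * deriv (g x) t| ≤ 1 / 2 := fun x t ht => by
    rw [abs_mul, abs_of_pos hδ]
    exact (mul_le_mul_of_nonneg_left (hbound x t ht).1 hδ.le).trans hδM.le
  have hess : ∀ x t, t ≤ 0 → ∀ v, v ≠ 0 → 1 / 2 * ‖v‖ ^ 2 <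
      fderiv ℝ (fderiv ℝ fun y => ‖y‖ ^ 2 / 2 - t + δ * g y t) x v v := fun x t ht v hv => by
    rw [sndFDeriv_half_norm_sq_sub_add (hgx t), real_inner_self_eq_norm_sq]
    have hv' : 0 < ‖v‖ ^ 2 := by positivity
    nlinarith [mul_le_mul_of_nonneg_left ((hbound x t ht).2 v) hδ.le]
  intro x t ht
  refine ⟨?_, ?_, ?_, fun x₁ x₂ l hl hl' => ?_, fun s hs => ?_⟩
  · have hd : Differentiable ℝ (fderiv ℝ fun y => ‖y‖ ^ 2 / 2 - t + δ * g y t) :=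
      ((hux t).fderiv_right (m := 1) (by norm_num)).differentiable (by norm_num)
    have hent : ∀ v w, fderiv ℝ (fun y => fderiv ℝ (fun z => ‖z‖ ^ 2 / 2 - t + δ * g z t) y w) x v =
        fderiv ℝ (fderiv ℝ fun y => ‖y‖ ^ 2 / 2 - t + δ * g y t) x v w := fun v w => by
      rw [fderiv_clm_apply (hd x) (differentiableAt_const w)]
      simp
    simp only [hent]
    exact EuclideanSpace.posDef_of_sub_half_smul_one
      ((hux t).contDiffAt.isSymmSndFDerivAt (by simp)) (hess x t ht)
  · rw [(hut x t).deriv]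
    linarith [(abs_le.1 (hδt x t ht)).2]
  · rw [(hut x t).deriv]
    linarith [(abs_le.1 (hδt x t ht)).1]
  · refine (convexOn_univ_of_sndFDeriv_nonneg (hux t) fun y v => ?_).2 (Set.mem_univ x₁)
      (Set.mem_univ x₂) hl (sub_nonneg.2 hl') (by ring)
    rcases eq_or_ne v 0 with rfl | hv
    · simp
    · exact le_trans (by positivity) (hess y t ht v hv).le
  · refine antitoneOn_of_deriv_nonpos (convex_Iic (0 : ℝ))
      (fun r _ => (hut x r).continuousAt.continuousWithinAt)
      (fun r _ => (hut x r).differentiableAt.differentiableWithinAt) (fun r hr => ?_)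
      (hs.trans ht) ht hs
    rw [interior_Iic] at hr
    rw [(hut x r).deriv]
    linarith [(abs_le.1 (hδt x r (le_of_lt hr))).2]
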